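/- arXiv:2505.17360 — 2 statements merged into one kernel-verified Lean document; each statement's English description precedes it below -/
import Mathlib

section
/- Let q ≥ n be a prime power and m ≥ 2. Sample x₀,…,x_{m-1} uniformly in F_q, sample α₁,…,α_N i.i.d. uniform in F_q, define β_i = Σ_j x_j α_i^j, and resample β_i uniformly whenever the value α_i repeats among α₁,…,α_N. Then the joint distribution of any m-1 of the pairs (α_i, β_i) is uniform on (F_q × F_q)^{m-1}. -/
open scoped Classical

/-- A map between finite types whose fibers all have the same size pushes the uniform
distribution forward to the uniform distribution. -/
theorem PMF.map_uniformOfFintype_of_card_fiber {X Y : Type*} [Fintype X] [Nonempty X]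
    [Fintype Y] [Nonempty Y] [DecidableEq Y] (f : X → Y)
    (h : ∀ y, (Finset.univ.filter fun x => f x = y).card * Fintype.card Y = Fintype.card X) :
    PMF.map f (PMF.uniformOfFintype X) = PMF.uniformOfFintype Y := by
  ext y
  have hX : (Fintype.card X : ENNReal) ≠ 0 := by simp
  have hy : ((Finset.univ.filter fun x => f x = y).card : ENNReal) * Fintype.card Y
      = Fintype.card X := by exact_mod_cast h y
  rw [PMF.map_apply, tsum_fintype]
  simp only [PMF.uniformOfFintype_apply, eq_comm (a := y)]
  rw [← Finset.sum_filter, Finset.sum_const, nsmul_eq_mul]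
  apply ENNReal.eq_inv_of_mul_eq_one_left
  rw [mul_right_comm, hy, ENNReal.mul_inv_cancel hX (ENNReal.natCast_ne_top _)]

/-- The fibers of a surjective homomorphism of finite groups all have the same size. -/
theorem AddMonoidHom.card_fiber_mul_card {G H : Type*} [AddGroup G] [AddGroup H] [Fintype G]
    [Fintype H] [DecidableEq H] (f : G →+ H) (hf : Function.Surjective f) (y : H) :
    (Finset.univ.filter fun x => f x = y).card * Fintype.card H = Fintype.card G := by
  have key : Fintype.card G = ∑ z : H, (Finset.univ.filter fun x => f x = z).card :=
    Finset.card_eq_sum_card_fiberwise (by simp)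
  rw [key, Finset.sum_congr rfl fun z _ =>
    AddMonoidHom.card_fiber_eq_of_mem_range f (hf z) (hf y)]
  simp [mul_comm]

/-- Values which are either free or evaluations of a polynomial with `m` free coefficients
at fewer than `m` distinct points, as an additive map of the free parameters. -/
def planted {F : Type*} [Field F] {N m k : ℕ} (ι : Fin k → Fin N) (p : Fin k → Prop)
    [DecidablePred p] (v : Fin k → F) : (Fin m → F) × (Fin N → F) →+ (Fin k → F) where
  toFun xr i := if p i then xr.2 (ι i) else ∑ j : Fin m, xr.1 j * v i ^ (j : ℕ)
  map_zero' := by ext i; simp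
  map_add' a b := by
    ext i
    by_cases h : p i <;> simp [h, add_mul, Finset.sum_add_distrib]

theorem planted_surjective {F : Type*} [Field F] {N m k : ℕ} (hk : k < m)
    {ι : Fin k → Fin N} (hι : Function.Injective ι) (p : Fin k → Prop) [DecidablePred p]
    (v : Fin k → F) (hv : Set.InjOn v {i | ¬ p i}) :
    Function.Surjective (planted (m := m) ι p v) := by
  intro b
  let s : Finset (Fin k) := Finset.univ.filter fun i => ¬ p i
  have hs : Set.InjOn v s := by simpa [s] using hv
  let P := Lagrange.interpolate s v b
  have hP : P.natDegree < m := by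
    rcases eq_or_ne P 0 with h0 | h0
    · rw [h0, Polynomial.natDegree_zero]; omega
    · rw [Polynomial.natDegree_lt_iff_degree_lt h0]
      refine (Lagrange.degree_interpolate_lt b hs).trans ?_
      have : s.card ≤ k := by simpa using s.card_le_univ
      exact_mod_cast this.trans_lt hk
  refine ⟨(fun j => P.coeff j, Function.extend ι b 0), ?_⟩
  ext i
  by_cases h : p i
  · simp [planted, h, hι.extend_apply]
  · have hi : P.eval (v i) = b i := Lagrange.eval_interpolate_at_node b hs (by simp [s, h])
    rw [Polynomial.eval_eq_sum_range' hP, Finset.sum_range] at hi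
    simpa [planted, h] using hi

/-- Restriction of functions along an index map, as an additive homomorphism. -/
def restrictHom (F : Type*) [AddCommGroup F] {α β : Type*} (ι : α → β) : (β → F) →+ (α → F) where
  toFun f := f ∘ ι
  map_zero' := rfl
  map_add' _ _ := rfl

/-- Planted-distribution marginal uniformity: random evaluation points with
resampling of β at repeated points yields (m-1)-wise uniformity of the pairs (α_i, β_i). -/
theorem stmt1 (N m q : ℕ) (hm : 2 ≤ m) (F : Type*) [Field F] [Fintype F] [DecidableEq F]
    (hq : Fintype.card F = q) (hqn : N ≤ q)
    (ι : Fin (m - 1) → Fin N) (hι : Function.Injective ι) :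
    PMF.map
      (fun xar : (Fin m → F) × (Fin N → F) × (Fin N → F) =>
        fun i : Fin (m - 1) =>
          (xar.2.1 (ι i),
            if ∃ j, j ≠ ι i ∧ xar.2.1 j = xar.2.1 (ι i) then xar.2.2 (ι i)
            else ∑ j : Fin m, xar.1 j * xar.2.1 (ι i) ^ (j : ℕ)))
      (PMF.uniformOfFintype ((Fin m → F) × (Fin N → F) × (Fin N → F)))
    = PMF.uniformOfFintype (Fin (m - 1) → F × F) := by
  apply PMF.map_uniformOfFintype_of_card_fiber
  intro y
  let p (a : Fin N → F) (i : Fin (m - 1)) : Prop := ∃ j, j ≠ ι i ∧ a j = a (ι i)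
  let L (a : Fin N → F) : (Fin m → F) × (Fin N → F) →+ (Fin (m - 1) → F) :=
    planted ι (p a) (a ∘ ι)
  have hL (a : Fin N → F) : Function.Surjective (L a) := by
    refine planted_surjective (by omega) hι _ _ fun i hi j _ hij => ?_
    by_contra hne
    exact hi ⟨ι j, fun h => hne (hι h).symm, hij.symm⟩
  have hR : Function.Surjective (restrictHom F ι) := fun b =>
    ⟨Function.extend ι b 0, by ext i; simp [restrictHom, hι.extend_apply]⟩
  have hfib : (Finset.univ.filter fun xar : (Fin m → F) × (Fin N → F) × (Fin N → F) =>
      (fun i : Fin (m - 1) => (xar.2.1 (ι i),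
            if ∃ j, j ≠ ι i ∧ xar.2.1 j = xar.2.1 (ι i) then xar.2.2 (ι i)
            else ∑ j : Fin m, xar.1 j * xar.2.1 (ι i) ^ (j : ℕ))) = y).card
      = ∑ a ∈ Finset.univ.filter fun a => restrictHom F ι a = fun i => (y i).1,
          (Finset.univ.filter fun xr => L a xr = fun i => (y i).2).card := by
    rw [← Finset.card_sigma]
    refine Finset.card_bij' (fun t _ => ⟨t.2.1, (t.1, t.2.2)⟩) (fun t _ => (t.2.1, t.1, t.2.2))
      ?_ ?_ (fun _ _ => rfl) (fun _ _ => rfl)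
    · intro t ht
      simp only [Finset.mem_filter_univ, funext_iff, Prod.ext_iff] at ht
      simp only [Finset.mem_sigma, Finset.mem_filter_univ, funext_iff]
      refine ⟨fun i => (ht i).1, fun i => ?_⟩
      rw [← (ht i).2]
      simp only [L, planted, p, AddMonoidHom.coe_mk, ZeroHom.coe_mk, Function.comp_apply]
    · intro t ht
      simp only [Finset.mem_sigma, Finset.mem_filter_univ, funext_iff] at ht
      simp only [Finset.mem_filter_univ, funext_iff, Prod.ext_iff]
      refine fun i => ⟨ht.1 i, ?_⟩
      rw [← ht.2 i]
      simp only [L, planted, p, AddMonoidHom.coe_mk, ZeroHom.coe_mk, Function.comp_apply]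
  have hcard : Fintype.card (Fin (m - 1) → F × F)
      = Fintype.card (Fin (m - 1) → F) * Fintype.card (Fin (m - 1) → F) := by
    simp [mul_pow]
  rw [hfib, hcard, ← mul_assoc, Finset.sum_mul,
    Finset.sum_congr rfl fun a _ => (L a).card_fiber_mul_card (hL a) _, Finset.sum_const,
    smul_eq_mul, mul_right_comm, (restrictHom F ι).card_fiber_mul_card hR]
  simp only [Fintype.card_prod]
  ring
end

section
/- Let γ ∈ (0,1), m ∈ ℕ, and let q(x)=Σ_{k=0}^d c_k L̃_k(x) be a degree-d polynomial with (1−γ)q(0)² + γ Σ_k c_k²/(2k+1) ≤ 1/m. Then for any 0 < λ* ≤ 1/(2d(d+1)), q(λ*) ≤ 1/√((1−γ)m) + λ* · √(1/(γm)) · √(Σ_{k=0}^d (2k+1)k²(k+1)²). -/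
open Finset

/-- The `i`-th term of the expansion at `0` of the Legendre polynomial of degree `k` shifted to
`[-1, 0]`. -/
def legendreTerm (k : ℕ) (x : ℝ) (i : ℕ) : ℝ :=
  (k.choose i : ℝ) * ((k + i).choose i : ℝ) * x ^ i

lemma legendreTerm_nonneg (k : ℕ) {x : ℝ} (hx : 0 ≤ x) (i : ℕ) : 0 ≤ legendreTerm k x i := by
  unfold legendreTerm
  positivity

lemma legendreTerm_zero (k : ℕ) (x : ℝ) : legendreTerm k x 0 = 1 := by
  simp [legendreTerm]

lemma legendreTerm_one (k : ℕ) (x : ℝ) : legendreTerm k x 1 = k * (k + 1) * x := by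
  simp [legendreTerm]

lemma choose_mul_choose_succ_le (k i : ℕ) :
    k.choose (i + 1) * (k + (i + 1)).choose (i + 1) * (i + 1) ^ 2
      ≤ k.choose i * (k + i).choose i * (k * (k + 1)) := by
  have h1 := Nat.choose_succ_right_eq k i
  have h2 := Nat.add_one_mul_choose_eq (k + i) i
  have h3 : (k - i) * (k + i + 1) ≤ k * (k + 1) := by
    rcases le_total i k with h | h
    · obtain ⟨j, rfl⟩ := Nat.exists_eq_add_of_le h
      simp only [Nat.add_sub_cancel_left]
      nlinarith [Nat.zero_le (i * i), Nat.zero_le i]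
    · simp [Nat.sub_eq_zero_of_le h]
  calc k.choose (i + 1) * (k + (i + 1)).choose (i + 1) * (i + 1) ^ 2
      = (k.choose (i + 1) * (i + 1)) * ((k + i + 1).choose (i + 1) * (i + 1)) := by
        rw [← add_assoc]; ring
    _ = k.choose i * (k + i).choose i * ((k - i) * (k + i + 1)) := by rw [h1, ← h2]; ring
    _ ≤ _ := Nat.mul_le_mul_left _ h3

lemma eight_mul_legendreTerm_le (k : ℕ) {x : ℝ} (hx : 0 ≤ x)
    (hkx : (k : ℝ) * (k + 1) * x ≤ 1 / 2) (i : ℕ) :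
    8 * legendreTerm k x (i + 2) ≤ legendreTerm k x (i + 1) := by
  have h := choose_mul_choose_succ_le k (i + 1)
  have hcast : ((k.choose (i + 2) : ℝ) * ((k + (i + 2)).choose (i + 2) : ℝ)) * ((i : ℝ) + 2) ^ 2
      ≤ (k.choose (i + 1) : ℝ) * ((k + (i + 1)).choose (i + 1) : ℝ) * (k * (k + 1)) := by
    have h' : ((i : ℝ) + 2) = ((i + 1 + 1 : ℕ) : ℝ) := by push_cast; ring
    rw [h']
    exact_mod_cast h
  have hmul : legendreTerm k x (i + 2) * ((i : ℝ) + 2) ^ 2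
      ≤ legendreTerm k x (i + 1) * (k * (k + 1) * x) := by
    have := mul_le_mul_of_nonneg_right hcast (pow_nonneg hx (i + 2))
    unfold legendreTerm
    calc _ = _ := by ring
      _ ≤ _ := this
      _ = _ := by ring
  have h4 : (4 : ℝ) ≤ ((i : ℝ) + 2) ^ 2 := by nlinarith [Nat.cast_nonneg (α := ℝ) i]
  nlinarith [mul_le_mul_of_nonneg_left h4 (legendreTerm_nonneg k hx (i + 2)),
    mul_le_mul_of_nonneg_left hkx (legendreTerm_nonneg k hx (i + 1))]

lemma sum_legendreTerm_bounds (k : ℕ) {x : ℝ} (hx : 0 ≤ x)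
    (hkx : (k : ℝ) * (k + 1) * x ≤ 1 / 2) :
    (k : ℝ) * (k + 1) * x ≤ ∑ i ∈ range (k + 1), legendreTerm k x i - 1 ∧
      ∑ i ∈ range (k + 1), legendreTerm k x i - 1 ≤ 8 / 7 * ((k : ℝ) * (k + 1) * x) := by
  have key : ∀ n : ℕ, 1 + (k : ℝ) * (k + 1) * x ≤ ∑ i ∈ range (n + 2), legendreTerm k x i ∧
      ∑ i ∈ range (n + 2), legendreTerm k x i
        ≤ 1 + 8 / 7 * ((k : ℝ) * (k + 1) * x) - legendreTerm k x (n + 1) / 7 := by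
    intro n
    induction n with
    | zero =>
      rw [sum_range_succ, sum_range_one, legendreTerm_zero, zero_add, legendreTerm_one]
      constructor <;> linarith
    | succ n ih =>
      rw [sum_range_succ]
      have h0 := legendreTerm_nonneg k hx (n + 2)
      have h1 := eight_mul_legendreTerm_le k hx hkx n
      constructor <;> linarith [ih.1, ih.2]
  cases k with
  | zero => simp [legendreTerm_zero]
  | succ n =>
    have h0 := legendreTerm_nonneg (n + 1) hx (n + 1)
    constructor <;> linarith [(key n).1, (key n).2]

lemma sum_two_mul_add_one (d : ℕ) :
    ∑ k ∈ range (d + 1), (2 * (k : ℝ) + 1) = ((d : ℝ) + 1) ^ 2 := by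
  induction d with
  | zero => simp
  | succ n ih => rw [sum_range_succ, ih]; push_cast; ring

lemma sum_two_mul_add_one_mul (d : ℕ) :
    ∑ k ∈ range (d + 1), (2 * (k : ℝ) + 1) * ((k : ℝ) * (k + 1))
      = (d : ℝ) * (d + 1) ^ 2 * (d + 2) / 2 := by
  induction d with
  | zero => simp
  | succ n ih => rw [sum_range_succ, ih]; push_cast; ring

lemma sum_two_mul_add_one_mul_sq (d : ℕ) :
    ∑ k ∈ range (d + 1), (2 * (k : ℝ) + 1) * (k : ℝ) ^ 2 * ((k : ℝ) + 1) ^ 2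
      = (d : ℝ) ^ 2 * (d + 1) ^ 2 * (d + 2) ^ 2 / 3 := by
  induction d with
  | zero => simp
  | succ n ih => rw [sum_range_succ, ih]; push_cast; ring

/-- Weighted Cauchy–Schwarz inequality with one extra coordinate. -/
lemma sq_add_sum_le_of_weights {ι : Type*} (s : Finset ι) {a : ℝ} (ha : 0 < a) {g : ℝ}
    (hg : 0 < g) {w : ι → ℝ} (hw : ∀ k ∈ s, 0 < w k) (b u : ℝ) (c v : ι → ℝ) :
    (b * u + ∑ k ∈ s, c k * v k) ^ 2
      ≤ (a * u ^ 2 + g * ∑ k ∈ s, c k ^ 2 / w k) * (b ^ 2 / a + (∑ k ∈ s, w k * v k ^ 2) / g) := by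
  set A := ∑ k ∈ s, c k ^ 2 / w k
  set B := ∑ k ∈ s, w k * v k ^ 2
  set T := ∑ k ∈ s, c k * v k
  have hA : 0 ≤ A := sum_nonneg fun k hk => div_nonneg (sq_nonneg _) (hw k hk).le
  have hB : 0 ≤ B := sum_nonneg fun k hk => mul_nonneg (hw k hk).le (sq_nonneg _)
  have hT : T ^ 2 ≤ A * B := by
    refine sum_sq_le_sum_mul_sum_of_sq_le_mul s (fun k hk => div_nonneg (sq_nonneg _) (hw k hk).le)
      (fun k hk => mul_nonneg (hw k hk).le (sq_nonneg _)) fun k hk => ?_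
    have := (hw k hk).ne'
    apply le_of_eq
    field_simp
  have hcross : 2 * (b * u * T) ≤ a * u ^ 2 * (B / g) + g * A * (b ^ 2 / a) := by
    have hsq : (b * u * T) ^ 2 ≤ (a * u ^ 2 * (B / g)) * (g * A * (b ^ 2 / a)) := by
      calc (b * u * T) ^ 2 = (b * u) ^ 2 * T ^ 2 := by ring
        _ ≤ (b * u) ^ 2 * (A * B) := by gcongr
        _ = _ := by field_simp
    have h1 : 0 ≤ a * u ^ 2 * (B / g) := by positivity
    have h2 : 0 ≤ g * A * (b ^ 2 / a) := by positivity
    refine le_of_abs_le (abs_le_of_sq_le_sq ?_ (add_nonneg h1 h2))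
    nlinarith [sq_nonneg (a * u ^ 2 * (B / g) - g * A * (b ^ 2 / a))]
  calc (b * u + T) ^ 2 = (b * u) ^ 2 + 2 * (b * u * T) + T ^ 2 := by ring
    _ ≤ (b * u) ^ 2 + (a * u ^ 2 * (B / g) + g * A * (b ^ 2 / a)) + A * B := by linarith
    _ = _ := by field_simp; ring

/-- Moments of `f` about a suitable shift `δ`, with weights `2k+1`, when `f k` is between
`k(k+1)x` and `8/7` times it. -/
lemma exists_shift_bound (d : ℕ) {x : ℝ} (hx : 0 ≤ x) (hdx : (d : ℝ) * (d + 1) * x ≤ 1 / 2)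
    {f : ℕ → ℝ} (hf : ∀ k ∈ range (d + 1), (k : ℝ) * (k + 1) * x ≤ f k ∧
      f k ≤ 8 / 7 * ((k : ℝ) * (k + 1) * x)) {p g P : ℝ} (hp : 0 ≤ p) (hg : 0 ≤ g) (hP : 0 ≤ P)
    (hP2 : P ^ 2 = x ^ 2 *
      ∑ k ∈ range (d + 1), (2 * (k : ℝ) + 1) * (k : ℝ) ^ 2 * ((k : ℝ) + 1) ^ 2) :
    ∃ δ : ℝ, (1 + δ) ^ 2 * p ^ 2
      + (∑ k ∈ range (d + 1), (2 * (k : ℝ) + 1) * (f k - δ) ^ 2) * g ^ 2 ≤ (p + P * g) ^ 2 := by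
  set M1 := ∑ k ∈ range (d + 1), (2 * (k : ℝ) + 1) * f k with hM1
  set M2 := ∑ k ∈ range (d + 1), (2 * (k : ℝ) + 1) * f k ^ 2 with hM2
  have hV (δ : ℝ) : ∑ k ∈ range (d + 1), (2 * (k : ℝ) + 1) * (f k - δ) ^ 2
      = M2 - 2 * δ * M1 + δ ^ 2 * ((d : ℝ) + 1) ^ 2 := by
    rw [← sum_two_mul_add_one, hM1, hM2, mul_sum, mul_sum, ← sum_sub_distrib, ← sum_add_distrib]
    exact sum_congr rfl fun k _ => by ring
  have hM2le : M2 ≤ 64 / 49 * P ^ 2 := by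
    rw [hP2, mul_sum, mul_sum]
    refine sum_le_sum fun k hk => ?_
    have h0 : 0 ≤ f k := le_trans (by positivity) (hf k hk).1
    calc (2 * (k : ℝ) + 1) * f k ^ 2
        ≤ (2 * (k : ℝ) + 1) * (8 / 7 * ((k : ℝ) * (k + 1) * x)) ^ 2 := by
          gcongr
          exact (hf k hk).2
      _ = _ := by ring
  have hM1ge : (d : ℝ) * (d + 1) ^ 2 * (d + 2) / 2 * x ≤ M1 := by
    rw [← sum_two_mul_add_one_mul, sum_mul]
    refine sum_le_sum fun k hk => ?_
    rw [mul_assoc]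
    gcongr
    exact (hf k hk).1
  have hM1le : M1 ≤ ((d : ℝ) + 1) ^ 2 := by
    rw [← sum_two_mul_add_one]
    refine sum_le_sum fun k hk => ?_
    have hkd : (k : ℝ) ≤ d := by exact_mod_cast mem_range_succ_iff.1 hk
    have : (k : ℝ) * (k + 1) * x ≤ (d : ℝ) * (d + 1) * x := by gcongr
    exact mul_le_of_le_one_right (by positivity) (by linarith [(hf k hk).2])
  rw [sum_two_mul_add_one_mul_sq] at hP2
  by_cases hc : 15 / 49 * (P * g) ≤ 2 * p
  · refine ⟨0, ?_⟩
    rw [hV]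
    have h1 := mul_le_mul_of_nonneg_right hM2le (sq_nonneg g)
    have h2 := mul_le_mul_of_nonneg_right hc (mul_nonneg hP hg)
    nlinarith
  · push Not at hc
    have hN : (0 : ℝ) < ((d : ℝ) + 1) ^ 2 := by positivity
    have hM1nonneg : 0 ≤ M1 := le_trans (by positivity) hM1ge
    refine ⟨M1 / ((d : ℝ) + 1) ^ 2, ?_⟩
    rw [hV]
    have hδ0 : 0 ≤ M1 / ((d : ℝ) + 1) ^ 2 := by positivity
    have hδ1 : M1 / ((d : ℝ) + 1) ^ 2 ≤ 1 := div_le_one_of_le₀ hM1le hN.le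
    have hvar : M2 - 2 * (M1 / ((d : ℝ) + 1) ^ 2) * M1
        + (M1 / ((d : ℝ) + 1) ^ 2) ^ 2 * ((d : ℝ) + 1) ^ 2 ≤ P ^ 2 := by
      have hsq : 3 / 4 * P ^ 2 ≤ M1 ^ 2 / ((d : ℝ) + 1) ^ 2 := by
        rw [le_div_iff₀ hN, hP2]
        calc _ = ((d : ℝ) * (d + 1) ^ 2 * (d + 2) / 2 * x) ^ 2 := by ring
          _ ≤ M1 ^ 2 := by gcongr
      have : M2 - 2 * (M1 / ((d : ℝ) + 1) ^ 2) * M1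
        + (M1 / ((d : ℝ) + 1) ^ 2) ^ 2 * ((d : ℝ) + 1) ^ 2
          = M2 - M1 ^ 2 / ((d : ℝ) + 1) ^ 2 := by field_simp; ring
      nlinarith [sq_nonneg P]
    generalize M1 / ((d : ℝ) + 1) ^ 2 = δ at *
    have h1 := mul_le_mul_of_nonneg_right hvar (sq_nonneg g)
    have h2 : (1 + δ) ^ 2 * p ^ 2 ≤ 4 * p ^ 2 := by
      gcongr
      nlinarith
    have h3 : 3 * p * p ≤ 2 * (P * g) * p :=
      mul_le_mul_of_nonneg_right (by linarith [mul_nonneg hP hg]) hp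
    nlinarith

/-- Bound on q(λ*): if (1-γ)q(0)² + γ Σ c_k²/(2k+1) ≤ 1/m and 0 < λ* ≤ 1/(2d(d+1)), then
q(λ*) ≤ 1/√((1-γ)m) + λ* √(1/(γm)) √(Σ (2k+1)k²(k+1)²). -/
theorem stmt16 (γ : ℝ) (hγ0 : 0 < γ) (hγ1 : γ < 1) (m : ℕ) (hm : 0 < m)
    (d : ℕ) (c : ℕ → ℝ) (lamstar : ℝ) (hls0 : 0 < lamstar)
    (hls1 : lamstar ≤ 1 / (2 * (d : ℝ) * ((d : ℝ) + 1)))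
    (Lt : ℕ → ℝ → ℝ)
    (hLt : ∀ k x, Lt k x
      = ∑ i ∈ Finset.range (k + 1), (k.choose i : ℝ) * ((k + i).choose i : ℝ) * x ^ i)
    (q : ℝ → ℝ) (hqdef : ∀ x, q x = ∑ k ∈ Finset.range (d + 1), c k * Lt k x)
    (hnorm : (1 - γ) * q 0 ^ 2
        + γ * ∑ k ∈ Finset.range (d + 1), c k ^ 2 / (2 * (k : ℝ) + 1) ≤ 1 / m) :
    q lamstar ≤ 1 / Real.sqrt ((1 - γ) * m)
      + lamstar * Real.sqrt (1 / (γ * m))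
        * Real.sqrt (∑ k ∈ Finset.range (d + 1),
            (2 * (k : ℝ) + 1) * (k : ℝ) ^ 2 * ((k : ℝ) + 1) ^ 2) := by
  have hdx : (d : ℝ) * (d + 1) * lamstar ≤ 1 / 2 := by
    rcases Nat.eq_zero_or_pos d with rfl | hd
    · simp
    · have hd' : (0 : ℝ) < d := by exact_mod_cast hd
      rw [le_div_iff₀ (by positivity)] at hls1
      linarith
  have hγ1' : 0 < 1 - γ := sub_pos.2 hγ1
  have hm' : (0 : ℝ) < m := by exact_mod_cast hm
  set S := ∑ k ∈ range (d + 1), (2 * (k : ℝ) + 1) * (k : ℝ) ^ 2 * ((k : ℝ) + 1) ^ 2 with hS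
  have hS0 : 0 ≤ S := sum_nonneg fun k _ => by positivity
  have hf : ∀ k ∈ range (d + 1), (k : ℝ) * (k + 1) * lamstar ≤ Lt k lamstar - 1 ∧
      Lt k lamstar - 1 ≤ 8 / 7 * ((k : ℝ) * (k + 1) * lamstar) := by
    intro k hk
    have hkd : (k : ℝ) ≤ d := by exact_mod_cast mem_range_succ_iff.1 hk
    have hkx : (k : ℝ) * (k + 1) * lamstar ≤ (d : ℝ) * (d + 1) * lamstar := by gcongr
    rw [hLt]
    exact sum_legendreTerm_bounds k hls0.le (hkx.trans hdx)
  obtain ⟨δ, hδ⟩ := exists_shift_bound d hls0.le hdx hf (p := 1 / √(1 - γ)) (g := 1 / √γ)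
    (P := lamstar * √S) (by positivity) (by positivity) (by positivity)
    (by rw [mul_pow, Real.sq_sqrt hS0])
  have hLt0 (k : ℕ) : Lt k 0 = 1 := by
    rw [hLt, sum_eq_single_of_mem 0 (by simp) fun i _ hi => by simp [hi]]
    simp
  have hq0 : q 0 = ∑ k ∈ range (d + 1), c k := by simp [hqdef, hLt0]
  have hq : q lamstar
      = (1 + δ) * q 0 + ∑ k ∈ range (d + 1), c k * (Lt k lamstar - 1 - δ) := by
    rw [hqdef lamstar, hq0, mul_sum, ← sum_add_distrib]
    exact sum_congr rfl fun k _ => by ring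
  have hCS := sq_add_sum_le_of_weights (range (d + 1)) hγ1' hγ0
    (w := fun k => 2 * (k : ℝ) + 1) (fun k _ => by positivity) (1 + δ) (q 0) c
    (fun k => Lt k lamstar - 1 - δ)
  rw [← hq] at hCS
  rw [div_pow, div_pow, Real.sq_sqrt hγ1'.le, Real.sq_sqrt hγ0.le, one_pow, mul_one_div,
    mul_one_div] at hδ
  have hB : 0 ≤ ∑ k ∈ range (d + 1), (2 * (k : ℝ) + 1) * (Lt k lamstar - 1 - δ) ^ 2 :=
    sum_nonneg fun k _ => by positivity
  have hrhs : 1 / √((1 - γ) * m) + lamstar * √(1 / (γ * m)) * √S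
      = 1 / √m * (1 / √(1 - γ) + lamstar * √S * (1 / √γ)) := by
    rw [Real.sqrt_mul hγ1'.le, Real.sqrt_div zero_le_one, Real.sqrt_one, Real.sqrt_mul hγ0.le]
    field_simp
  rw [hrhs]
  refine le_of_abs_le (abs_le_of_sq_le_sq ?_ (by positivity))
  rw [mul_pow, div_pow, Real.sq_sqrt hm'.le, one_pow]
  exact hCS.trans (mul_le_mul hnorm hδ (by positivity) (by positivity))
end
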